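/- Let N ≥ 1, let α_1, …, α_N, β_1, …, β_N and γ_1, …, γ_{N+1} all be positive reals, let ᾱ_1, …, ᾱ_N and β̄_1, …, β̄_N be reals, and let z_0, z_{N+1} be fixed reals. Define f : ℝ^N → ℝ by f(z) = Σ_{i=1}^N ( α_i |z_i − ᾱ_i| + β_i |z_i − β̄_i| ) + Σ_{i=1}^{N+1} γ_i |z_i − z_{i−1}|, where in the second sum z_0 and z_{N+1} denote the fixed constants. Let 𝒵 = {ᾱ_1, …, ᾱ_N, β̄_1, …, β̄_N, z_0, z_{N+1}}. Then there exists a global minimizer z* of f (f(z*) ≤ f(z) for all z ∈ ℝ^N) with z*_i ∈ 𝒵 for every i = 1, …, N; consequently the infimum of f over ℝ^N equals the minimum of f over the finite set 𝒵^N. -/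

import Mathlib

/-- The vector `z ∈ ℝ^N` extended by the fixed boundary constants `z0` (at index 0)
and `zN1` (at index N+1). -/
noncomputable def extVec (N : ℕ) (z0 zN1 : ℝ) (z : Fin N → ℝ) : Fin (N + 2) → ℝ :=
  fun j =>
    if h0 : (j : ℕ) = 0 then z0
    else if hN : (j : ℕ) = N + 1 then zN1
    else z ⟨(j : ℕ) - 1, by omega⟩

/-- The global optimal reference field objective
`f z = ∑_{i=1}^N (α_i |z_i − ᾱ_i| + β_i |z_i − β̄_i|) + ∑_{i=1}^{N+1} γ_i |z_i − z_{i−1}|`,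
where `z_0` and `z_{N+1}` in the last sum are the fixed constants. -/
noncomputable def objF (N : ℕ) (al be : Fin N → ℝ) (ga : Fin (N + 1) → ℝ)
    (alb bbb : Fin N → ℝ) (z0 zN1 : ℝ) (z : Fin N → ℝ) : ℝ :=
  (∑ i : Fin N, (al i * |z i - alb i| + be i * |z i - bbb i|)) +
    ∑ j : Fin (N + 1),
      ga j * |extVec N z0 zN1 z j.succ - extVec N z0 zN1 z j.castSucc|

/-- A weighted sum of distances `|a k - b k|` does not increase under one of the
rounding maps that send a single value `c` to a point of the nonempty finite set `T`. -/
theorem exists_update_sum_abs_sub_le {ι : Type*} [Fintype ι] (w a b : ι → ℝ) (hw : ∀ k, 0 ≤ w k)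
    (T : Finset ℝ) (hT : T.Nonempty) (c : ℝ) (hc : c ∉ T)
    (ha : ∀ k, a k ∈ insert c T) (hb : ∀ k, b k ∈ insert c T) :
    ∃ p ∈ T, ∑ k, w k * |Function.update id c p (a k) - Function.update id c p (b k)| ≤
      ∑ k, w k * |a k - b k| := by
  have hlow : (∃ p ∈ T, p < c) → ∃ p ∈ T, p < c ∧ ∀ t ∈ T, t < c → t ≤ p := by
    rintro ⟨p, hp, hpc⟩
    obtain ⟨m, hm, hmax⟩ := (T.filter (· < c)).exists_max_image id ⟨p, by simp [hp, hpc]⟩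
    simp only [Finset.mem_filter, id] at hm hmax
    exact ⟨m, hm.1, hm.2, fun t ht htc => hmax t ⟨ht, htc⟩⟩
  have hupp : (∃ q ∈ T, c < q) → ∃ q ∈ T, c < q ∧ ∀ t ∈ T, c < t → q ≤ t := by
    rintro ⟨p, hp, hpc⟩
    obtain ⟨m, hm, hmin⟩ := (T.filter (c < ·)).exists_min_image id ⟨p, by simp [hp, hpc]⟩
    simp only [Finset.mem_filter, id] at hm hmin
    exact ⟨m, hm.1, hm.2, fun t ht htc => hmin t ⟨ht, htc⟩⟩
  have hside : ∀ t ∈ T, t < c ∨ c < t := fun t ht =>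
    lt_or_gt_of_ne fun h => hc (h ▸ ht)
  have hcontr : ∀ p, (∀ t ∈ T, |p - t| ≤ |c - t|) →
      ∑ k, w k * |Function.update id c p (a k) - Function.update id c p (b k)| ≤
        ∑ k, w k * |a k - b k| := by
    intro p h
    refine Finset.sum_le_sum fun k _ => mul_le_mul_of_nonneg_left ?_ (hw k)
    have hak := ha k
    have hbk := hb k
    rw [Finset.mem_insert] at hak hbk
    by_cases h1 : a k = c <;> by_cases h2 : b k = c
    · simp [h1, h2]
    · simpa [h1, h2] using h _ (hbk.resolve_left h2)
    · simpa [h1, h2, abs_sub_comm] using h _ (hak.resolve_left h1)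
    · simp [h1, h2]
  by_cases hL : ∃ p ∈ T, p < c
  · obtain ⟨p, hp, hpc, hpm⟩ := hlow hL
    by_cases hU : ∃ q ∈ T, c < q
    · obtain ⟨q, hq, hcq, hqm⟩ := hupp hU
      have hdist : ∀ t ∈ T, (q - c) * |p - t| + (c - p) * |q - t| = (q - p) * |c - t| := by
        intro t ht
        rcases hside t ht with h | h
        · have := hpm t ht h
          rw [abs_of_nonneg (by linarith : 0 ≤ p - t), abs_of_nonneg (by linarith : 0 ≤ q - t),
            abs_of_nonneg (by linarith : 0 ≤ c - t)]
          ring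
        · have := hqm t ht h
          rw [abs_of_nonpos (by linarith : p - t ≤ 0), abs_of_nonpos (by linarith : q - t ≤ 0),
            abs_of_nonpos (by linarith : c - t ≤ 0)]
          ring
      have hpair : ∀ k,
          (q - c) * |Function.update id c p (a k) - Function.update id c p (b k)| +
            (c - p) * |Function.update id c q (a k) - Function.update id c q (b k)| =
          (q - p) * |a k - b k| := by
        intro k
        have hak := ha k
        have hbk := hb k
        rw [Finset.mem_insert] at hak hbk
        by_cases h1 : a k = c <;> by_cases h2 : b k = c
        · simp [h1, h2]
        · simpa [h1, h2] using hdist _ (hbk.resolve_left h2)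
        · simpa [h1, h2, abs_sub_comm] using hdist _ (hak.resolve_left h1)
        · simp only [Function.update_of_ne h1, Function.update_of_ne h2, id]
          ring
      have hsum : (q - c) *
            ∑ k, w k * |Function.update id c p (a k) - Function.update id c p (b k)| +
          (c - p) * ∑ k, w k * |Function.update id c q (a k) - Function.update id c q (b k)| =
          (q - p) * ∑ k, w k * |a k - b k| := by
        simp only [Finset.mul_sum, ← Finset.sum_add_distrib]
        refine Finset.sum_congr rfl fun k _ => ?_
        linear_combination w k * hpair k
      by_contra! hcon
      nlinarith [mul_lt_mul_of_pos_left (hcon p hp) (sub_pos.2 hcq),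
        mul_lt_mul_of_pos_left (hcon q hq) (sub_pos.2 hpc)]
    · push Not at hU
      refine ⟨p, hp, hcontr p fun t ht => ?_⟩
      have htc := (hside t ht).resolve_right (hU t ht).not_gt
      have := hpm t ht htc
      rw [abs_of_nonneg (by linarith : 0 ≤ p - t), abs_of_nonneg (by linarith : 0 ≤ c - t)]
      linarith
  · push Not at hL
    have habove : ∀ t ∈ T, c < t := fun t ht => (hside t ht).resolve_left (hL t ht).not_gt
    obtain ⟨t₀, ht₀⟩ := hT
    obtain ⟨q, hq, hcq, hqm⟩ := hupp ⟨t₀, ht₀, habove t₀ ht₀⟩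
    refine ⟨q, hq, hcontr q fun t ht => ?_⟩
    have := hqm t ht (habove t ht)
    rw [abs_of_nonpos (by linarith : q - t ≤ 0), abs_of_nonpos (by linarith : c - t ≤ 0)]
    linarith

/-- All values outside a nonempty finite set `S` can be rounded into `S`, fixing `S` pointwise,
without increasing a given weighted sum of distances. -/
theorem exists_rounding_sum_abs_sub_le {ι : Type*} [Fintype ι] (w : ι → ℝ) (hw : ∀ k, 0 ≤ w k)
    (S : Finset ℝ) (hS : S.Nonempty) (D : Finset ℝ) :
    ∀ a b : ι → ℝ, (∀ k, a k ∈ S ∪ D) → (∀ k, b k ∈ S ∪ D) →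
      ∃ φ : ℝ → ℝ, (∀ s ∈ S, φ s = s) ∧ (∀ d ∈ D, φ d ∈ S) ∧
        ∑ k, w k * |φ (a k) - φ (b k)| ≤ ∑ k, w k * |a k - b k| := by
  induction D using Finset.induction_on with
  | empty => exact fun a b _ _ => ⟨id, by simp, by simp, le_rfl⟩
  | insert c D _ ih =>
    intro a b ha hb
    rw [Finset.union_insert] at ha hb
    by_cases hc : c ∈ S ∪ D
    · rw [Finset.insert_eq_of_mem hc] at ha hb
      obtain ⟨φ, h1, h2, h3⟩ := ih a b ha hb
      refine ⟨φ, h1, fun d hd => ?_, h3⟩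
      have hd' : d ∈ S ∪ D := by
        rcases Finset.mem_insert.1 hd with rfl | hd
        · exact hc
        · exact Finset.mem_union_right _ hd
      rcases Finset.mem_union.1 hd' with hd | hd
      · rwa [h1 d hd]
      · exact h2 d hd
    · obtain ⟨p, hp, hle⟩ := exists_update_sum_abs_sub_le w a b hw (S ∪ D)
        (hS.mono Finset.subset_union_left) c hc ha hb
      have hmem : ∀ x ∈ insert c (S ∪ D), Function.update id c p x ∈ S ∪ D := by
        intro x hx
        by_cases h : x = c
        · simpa [h] using hp
        · simpa [h] using hx
      obtain ⟨φ, h1, h2, h3⟩ := ih _ _ (fun k => hmem _ (ha k)) (fun k => hmem _ (hb k))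
      refine ⟨φ ∘ Function.update id c p, fun s hs => ?_, fun d hd => ?_, h3.trans hle⟩
      · have : s ≠ c := by
          rintro rfl
          exact hc (Finset.mem_union_left _ hs)
        simpa [this] using h1 s hs
      · have := hmem d (Finset.insert_subset_insert c Finset.subset_union_right hd)
        rcases Finset.mem_union.1 this with h | h
        · simpa [h1 _ h] using h
        · exact h2 _ h

theorem extVec_comp (N : ℕ) (z0 zN1 : ℝ) (z : Fin N → ℝ) (φ : ℝ → ℝ) (h0 : φ z0 = z0)
    (h1 : φ zN1 = zN1) (j : Fin (N + 2)) :
    extVec N z0 zN1 (φ ∘ z) j = φ (extVec N z0 zN1 z j) := by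
  unfold extVec
  split_ifs <;> simp [h0, h1]

theorem extVec_mem (N : ℕ) (z0 zN1 : ℝ) (z : Fin N → ℝ) (U : Finset ℝ) (h0 : z0 ∈ U)
    (h1 : zN1 ∈ U) (hz : ∀ i, z i ∈ U) (j : Fin (N + 2)) : extVec N z0 zN1 z j ∈ U := by
  unfold extVec
  split_ifs
  exacts [h0, h1, hz _]

theorem exists_candidate_objF_le (N : ℕ) (al be : Fin N → ℝ) (ga : Fin (N + 1) → ℝ)
    (alb bbb : Fin N → ℝ) (z0 zN1 : ℝ)
    (hal : ∀ i, 0 ≤ al i) (hbe : ∀ i, 0 ≤ be i) (hga : ∀ i, 0 ≤ ga i) (z : Fin N → ℝ) :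
    ∃ y : Fin N → ℝ, (∀ i, y i ∈ Set.range alb ∪ Set.range bbb ∪ {z0, zN1}) ∧
      objF N al be ga alb bbb z0 zN1 y ≤ objF N al be ga alb bbb z0 zN1 z := by
  classical
  set S : Finset ℝ := Finset.univ.image alb ∪ Finset.univ.image bbb ∪ {z0, zN1} with hSdef
  have hSmem : ∀ x, x ∈ S ↔ x ∈ Set.range alb ∪ Set.range bbb ∪ {z0, zN1} := by
    intro x
    simp [hSdef]
  have hz0 : z0 ∈ S := by simp [hSdef]
  have hz1 : zN1 ∈ S := by simp [hSdef]
  have halb : ∀ i, alb i ∈ S := fun i => by simp [hSdef]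
  have hbbb : ∀ i, bbb i ∈ S := fun i => by simp [hSdef]
  have hz : ∀ i, z i ∈ S ∪ Finset.univ.image z := fun i =>
    Finset.mem_union_right _ (Finset.mem_image_of_mem z (Finset.mem_univ i))
  have hext := extVec_mem N z0 zN1 z _ (Finset.mem_union_left (Finset.univ.image z) hz0)
    (Finset.mem_union_left _ hz1) hz
  obtain ⟨φ, h1, h2, h3⟩ := exists_rounding_sum_abs_sub_le
    (Sum.elim (Sum.elim al be) ga) (by rintro ((i | i) | i) <;> simp [hal, hbe, hga])
    S ⟨z0, hz0⟩ (Finset.univ.image z)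
    (Sum.elim (Sum.elim z z) fun j => extVec N z0 zN1 z j.succ)
    (Sum.elim (Sum.elim alb bbb) fun j => extVec N z0 zN1 z j.castSucc)
    (by
      rintro ((i | i) | i)
      exacts [hz i, hz i, hext _])
    (by
      rintro ((i | i) | i)
      exacts [Finset.mem_union_left _ (halb i), Finset.mem_union_left _ (hbbb i), hext _])
  refine ⟨φ ∘ z, fun i => (hSmem _).1 (h2 _ (Finset.mem_image_of_mem z (Finset.mem_univ i))), ?_⟩
  simpa [objF, Fintype.sum_sum_type, Finset.sum_add_distrib, h1 _ (halb _), h1 _ (hbbb _),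
    extVec_comp N z0 zN1 z φ (h1 _ hz0) (h1 _ hz1)] using h3

/-- with all coefficients positive, there is a global minimizer of the
objective `f` all of whose components lie in the finite candidate set
`𝒵 = {ᾱ_1, …, ᾱ_N, β̄_1, …, β̄_N, z_0, z_{N+1}}`; consequently the infimum of `f`
over `ℝ^N` equals the infimum (minimum) of `f` over the finite set `𝒵^N`. -/
theorem exists_minimizer_in_candidate_set
    (N : ℕ) (hN : 1 ≤ N)
    (al be : Fin N → ℝ) (ga : Fin (N + 1) → ℝ)
    (alb bbb : Fin N → ℝ) (z0 zN1 : ℝ)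
    (hal : ∀ i, 0 < al i) (hbe : ∀ i, 0 < be i) (hga : ∀ i, 0 < ga i) :
    (∃ zstar : Fin N → ℝ,
      (∀ i : Fin N, zstar i ∈ Set.range alb ∪ Set.range bbb ∪ {z0, zN1}) ∧
      ∀ z : Fin N → ℝ,
        objF N al be ga alb bbb z0 zN1 zstar ≤ objF N al be ga alb bbb z0 zN1 z) ∧
    sInf (Set.range (objF N al be ga alb bbb z0 zN1)) =
      sInf (objF N al be ga alb bbb z0 zN1 ''
        {z : Fin N → ℝ |
          ∀ i : Fin N, z i ∈ Set.range alb ∪ Set.range bbb ∪ {z0, zN1}}) := by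
  set A : Set (Fin N → ℝ) :=
    {z | ∀ i : Fin N, z i ∈ Set.range alb ∪ Set.range bbb ∪ {z0, zN1}} with hA
  have hround := exists_candidate_objF_le N al be ga alb bbb z0 zN1 (fun i => (hal i).le)
    (fun i => (hbe i).le) (fun i => (hga i).le)
  have hfin : A.Finite := by
    have hZ : (Set.range alb ∪ Set.range bbb ∪ {z0, zN1}).Finite :=
      ((Set.finite_range alb).union (Set.finite_range bbb)).union (Set.toFinite _)
    exact Set.Finite.pi' fun _ => hZ
  obtain ⟨y, hy, hmin⟩ := Set.exists_min_image A (objF N al be ga alb bbb z0 zN1) hfin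
    ⟨fun _ => z0, fun _ => by simp⟩
  have hglob : ∀ z, objF N al be ga alb bbb z0 zN1 y ≤ objF N al be ga alb bbb z0 zN1 z := by
    intro z
    obtain ⟨x, hx, hxz⟩ := hround z
    exact (hmin x hx).trans hxz
  refine ⟨⟨y, hy, hglob⟩, ?_⟩
  have hleast : IsLeast (Set.range (objF N al be ga alb bbb z0 zN1))
      (objF N al be ga alb bbb z0 zN1 y) := ⟨⟨y, rfl⟩, by rintro _ ⟨z, rfl⟩; exact hglob z⟩
  have hleast' : IsLeast (objF N al be ga alb bbb z0 zN1 '' A)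
      (objF N al be ga alb bbb z0 zN1 y) := ⟨⟨y, hy, rfl⟩, by rintro _ ⟨z, _, rfl⟩; exact hglob z⟩
  rw [hleast.csInf_eq, hleast'.csInf_eq]
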